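/- Let S from H₀ to H₁ and T from H₁ to H₂ be closed densely defined operators between complex Hilbert spaces with range S ⊆ ker T (a Hilbert complex). Then the composition of the inclusion ker T ∩ ker S† ↪ ker T with the quotient map ker T → ker T / closure(range S) is a linear bijection; that is, the reduced cohomology of the complex is isomorphic to ker T ∩ ker S†. -/

import Mathlib

/-!
STATEMENT 9: Let S : H₀ → H₁ and T : H₁ → H₂ be closed densely defined operators between
complex Hilbert spaces with range S ⊆ ker T (a Hilbert complex). Then the composition of
the inclusion ker T ∩ ker S† ↪ ker T with the quotient map ker T → ker T / closure(range S)
is a linear bijection; that is, the reduced cohomology of the complex is isomorphic to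
ker T ∩ ker S†.
-/

noncomputable section

/-- The kernel of a partially defined operator, as a submodule of the ambient space. -/
def pKer {R E F : Type*} [Ring R] [AddCommGroup E] [Module R E] [AddCommGroup F] [Module R F]
    (P : E →ₗ.[R] F) : Submodule R E :=
  (LinearMap.ker P.toFun).map P.domain.subtype

/-- The range of a partially defined operator. -/
def pRan {R E F : Type*} [Ring R] [AddCommGroup E] [Module R E] [AddCommGroup F] [Module R F]
    (P : E →ₗ.[R] F) : Submodule R F :=
  LinearMap.range P.toFun

theorem mem_pKer_iff {R E F : Type*} [Ring R] [AddCommGroup E] [Module R E] [AddCommGroup F]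
    [Module R F] (P : E →ₗ.[R] F) (x : E) : x ∈ pKer P ↔ (x, (0 : F)) ∈ P.graph := by
  simp only [pKer, Submodule.mem_map, LinearMap.mem_ker, LinearPMap.mem_graph_iff]
  exact exists_congr fun _ => and_comm

/-- The kernel of a closed operator is closed. -/
theorem isClosed_pKer {E F : Type*} [NormedAddCommGroup E] [InnerProductSpace ℂ E]
    [NormedAddCommGroup F] [InnerProductSpace ℂ F] {P : E →ₗ.[ℂ] F} (hP : P.IsClosed) :
    IsClosed (pKer P : Set E) := by
  have h : (pKer P : Set E) = (fun x => (x, (0 : F))) ⁻¹' (P.graph : Set (E × F)) :=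
    Set.ext fun x => mem_pKer_iff P x
  rw [h]
  exact IsClosed.preimage (by fun_prop) hP

/-- The kernel of the adjoint is the orthogonal complement of the range. -/
theorem pKer_adjoint {E F : Type*} [NormedAddCommGroup E] [InnerProductSpace ℂ E] [CompleteSpace E]
    [NormedAddCommGroup F] [InnerProductSpace ℂ F] {P : E →ₗ.[ℂ] F}
    (hP : Dense (P.domain : Set E)) : pKer P.adjoint = (pRan P)ᗮ := by
  ext y
  rw [Submodule.mem_orthogonal']
  constructor
  · rintro ⟨v, hv, rfl⟩ _ ⟨x, rfl⟩
    have h := LinearPMap.adjoint_isFormalAdjoint hP v x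
    have hv' : P.adjoint v = 0 := hv
    rw [hv', inner_zero_left] at h
    exact h.symm
  · intro hy
    have h : ∀ x : P.domain, inner ℂ (0 : E) x = inner ℂ y (P x) := fun x => by
      rw [inner_zero_left, hy (P x) ⟨x, rfl⟩]
    exact ⟨⟨y, LinearPMap.mem_adjoint_domain_of_exists y ⟨0, h⟩⟩,
      LinearPMap.adjoint_apply_eq hP _ h, rfl⟩

theorem reduced_cohomology_iso_harmonics
    {H₀ H₁ H₂ : Type*}
    [NormedAddCommGroup H₀] [InnerProductSpace ℂ H₀] [CompleteSpace H₀]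
    [NormedAddCommGroup H₁] [InnerProductSpace ℂ H₁] [CompleteSpace H₁]
    [NormedAddCommGroup H₂] [InnerProductSpace ℂ H₂] [CompleteSpace H₂]
    (S : H₀ →ₗ.[ℂ] H₁) (T : H₁ →ₗ.[ℂ] H₂)
    (hSd : Dense (S.domain : Set H₀)) (hSc : S.IsClosed)
    (hTd : Dense (T.domain : Set H₁)) (hTc : T.IsClosed)
    (hST : pRan S ≤ pKer T) :
    Function.Bijective
      (((Submodule.comap (pKer T).subtype
            ((pRan S).topologicalClosure)).mkQ).comp
        (Submodule.inclusion (inf_le_left : pKer T ⊓ pKer S.adjoint ≤ pKer T))) := by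
  have hker : pKer S.adjoint = (pRan S).topologicalClosureᗮ := by
    rw [pKer_adjoint hSd, Submodule.orthogonal_closure]
  have hle : (pRan S).topologicalClosure ≤ pKer T :=
    Submodule.topologicalClosure_minimal _ hST (isClosed_pKer hTc)
  have : CompleteSpace (pRan S).topologicalClosure :=
    (pRan S).isClosed_topologicalClosure.completeSpace_coe
  constructor
  · rw [injective_iff_map_eq_zero]
    rintro ⟨x, hxT, hxS⟩ hx
    have hx' : x ∈ (pRan S).topologicalClosure := by
      simpa [Submodule.Quotient.mk_eq_zero] using hx
    rw [hker] at hxS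
    exact Subtype.ext (Submodule.disjoint_def.1 (Submodule.orthogonal_disjoint _) x hx' hxS)
  · intro q
    obtain ⟨⟨z, hz⟩, rfl⟩ := Submodule.mkQ_surjective _ q
    obtain ⟨y, hy, w, hw, rfl⟩ := (pRan S).topologicalClosure.exists_add_mem_mem_orthogonal z
    have hwT : w ∈ pKer T := by simpa using sub_mem hz (hle hy)
    refine ⟨⟨w, hwT, hker ▸ hw⟩, (Submodule.Quotient.eq _).2 ?_⟩
    simpa using hy
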